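/- arXiv:1509.02591 — 3 statements merged into one kernel-verified Lean document; each statement's English description precedes it below -/
import Mathlib

section
/- Let f be a cw-expansive homeomorphism of a continuum X satisfying condition (PA). If there exists a stable continuum with more than one point, then there is δ > 0 such that for every x ∈ X there is a stable continuum A with diam(A) = δ and x ∈ A. -/
open Metric Set Filter TopologicalSpace

/-- The hyperspace of continua (nonempty compact connected subsets) of `X`,
with the Hausdorff distance as its metric. -/
abbrev Continua (X : Type*) [MetricSpace X] :=
  {K : TopologicalSpace.NonemptyCompacts X // IsConnected (K : Set X)}

variable {X : Type*} [MetricSpace X]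

/-- The image of a set under the n-th power (n : ℤ) of a homeomorphism. -/
def zim (f : X ≃ₜ X) : ℤ → Set X → Set X
  | (Int.ofNat n), A => (⇑f)^[n] '' A
  | (Int.negSucc n), A => (⇑f.symm)^[n+1] '' A

/-- A homeomorphism is cw-expansive if some δ > 0 satisfies: every connected
subset with more than one point has some iterate of diameter greater than δ. -/
def IsCWExpansive (f : X ≃ₜ X) : Prop :=
  ∃ δ > 0, ∀ A : Set X, IsConnected A → A.Nontrivial →
    ∃ n : ℤ, δ < Metric.diam (zim f n A)

/-- Wˢ_f : the set of stable continua, i.e. those with diam(fⁿ(A)) → 0 as n → +∞. -/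
def Ws (f : X ≃ₜ X) : Set (Continua X) :=
  {A | Tendsto (fun n : ℕ => Metric.diam ((⇑f)^[n] '' (A.1 : Set X))) atTop (nhds 0)}

/-- Wᵘ_f : the set of unstable continua, i.e. the stable continua of f⁻¹. -/
def Wu (f : X ≃ₜ X) : Set (Continua X) := Ws f.symm

/-- i(A): the set of subcontinua of A, as a subset of the hyperspace. -/
def iSet (A : Continua X) : Set (Continua X) := {B | (B.1 : Set X) ⊆ (A.1 : Set X)}

/-- Condition (PA): for every nontrivial stable continuum Aˢ,
dist_{H²}(i(f^{-n}(Aˢ)), F̃ˢ) → 0, and for every nontrivial unstable continuum Aᵘ,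
dist_{H²}(i(fⁿ(Aᵘ)), F̃ᵘ) → 0, where F̃ˢ, F̃ᵘ are the closures of Wˢ_f, Wᵘ_f
in the hyperspace. -/
def CondPA (f : X ≃ₜ X) : Prop :=
  (∀ A : Continua X, A ∈ Ws f → (A.1 : Set X).Nontrivial →
    Tendsto (fun n : ℕ =>
      hausdorffDist {B : Continua X | (B.1 : Set X) ⊆ (⇑f.symm)^[n] '' (A.1 : Set X)}
        (closure (Ws f))) atTop (nhds 0)) ∧
  (∀ A : Continua X, A ∈ Wu f → (A.1 : Set X).Nontrivial →
    Tendsto (fun n : ℕ =>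
      hausdorffDist {B : Continua X | (B.1 : Set X) ⊆ (⇑f)^[n] '' (A.1 : Set X)}
        (closure (Wu f))) atTop (nhds 0))

/-- Boundary bumping: in a continuum `K`, the component of `x` in a sublevel set of a continuous
function reaches the level, provided `K` does. -/
theorem IsPreconnected.exists_continuum_reaching_level {K : Set X} (hK : IsPreconnected K)
    (hKc : IsCompact K) {g : X → ℝ} (hg : Continuous g) {x z : X} {r : ℝ} (hx : x ∈ K)
    (hxr : g x ≤ r) (hz : z ∈ K) (hzr : r ≤ g z) :
    ∃ C ⊆ K, IsCompact C ∧ IsConnected C ∧ x ∈ C ∧ (∀ y ∈ C, g y ≤ r) ∧ ∃ y ∈ C, g y = r := by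
  have hF : IsCompact (K ∩ g ⁻¹' Iic r) := hKc.inter_right (isClosed_Iic.preimage hg)
  set F := K ∩ g ⁻¹' Iic r with hFdef
  have : CompactSpace F := isCompact_iff_compactSpace.mp hF
  let x' : F := ⟨x, hx, hxr⟩
  refine ⟨Subtype.val '' connectedComponent x', ?_, ?_, ?_, ⟨x', mem_connectedComponent, rfl⟩,
    ?_, ?_⟩
  · rintro _ ⟨y, -, rfl⟩
    exact y.2.1
  · exact isClosed_connectedComponent.isCompact.image continuous_subtype_val
  · exact isConnected_connectedComponent.image _ continuous_subtype_val.continuousOn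
  · rintro _ ⟨y, -, rfl⟩
    exact y.2.2
  by_contra! hne
  have hlt : connectedComponent x' ⊆ {y : F | g y < r} := fun y hy =>
    lt_of_le_of_ne y.2.2 (hne y ⟨y, hy, rfl⟩)
  have hopen : IsOpen {y : F | g y < r} :=
    isOpen_lt (hg.comp continuous_subtype_val) continuous_const
  rw [connectedComponent_eq_iInter_isClopen] at hlt
  obtain ⟨⟨V, hV, hxV⟩, hVr⟩ : ∃ i : {s : Set F // IsClopen s ∧ x' ∈ s},
      (i : Set F) ⊆ {y : F | g y < r} := by
    have : Nonempty {s : Set F // IsClopen s ∧ x' ∈ s} := ⟨⟨univ, isClopen_univ, mem_univ _⟩⟩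
    refine exists_subset_nhds_of_compactSpace (V := fun i : {s : Set F // IsClopen s ∧ x' ∈ s} =>
      (i : Set F)) ?_ (fun i => i.2.1.1) (fun y hy => hopen.mem_nhds (hlt hy))
    rintro ⟨s, hs, hxs⟩ ⟨t, ht, hxt⟩
    exact ⟨⟨s ∩ t, hs.inter ht, hxs, hxt⟩, inter_subset_left, inter_subset_right⟩
  obtain ⟨O, hO, rfl⟩ := isOpen_induced_iff.mp hV.2
  have hVcl : IsClosed (Subtype.val '' (Subtype.val ⁻¹' O : Set F)) :=
    (hV.1.isCompact.image continuous_subtype_val).isClosed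
  obtain ⟨y, hyK, ⟨hyO, hyr⟩, hyV⟩ := hK (O ∩ {y | g y < r}) _
    (hO.inter (isOpen_lt hg continuous_const)) hVcl.isOpen_compl
    (fun y _ => by
      by_cases hy : y ∈ Subtype.val '' (Subtype.val ⁻¹' O : Set F)
      · obtain ⟨w, hw, rfl⟩ := hy
        exact Or.inl ⟨hw, hVr hw⟩
      · exact Or.inr hy)
    ⟨x, hx, hxV, hVr hxV⟩
    ⟨z, hz, by
      rintro ⟨w, hw, rfl⟩
      exact absurd (hVr hw) (not_lt.mpr hzr)⟩
  exact hyV ⟨⟨y, hyK, show g y ≤ r from le_of_lt hyr⟩, hyO, rfl⟩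

/-- A continuum contains, through each of its points, subcontinua of every smaller diameter. -/
theorem IsPreconnected.exists_continuum_diam_eq {K : Set X} (hK : IsPreconnected K)
    (hKc : IsCompact K) {x : X} (hx : x ∈ K) {δ : ℝ} (hδ : 0 ≤ δ) (hδK : δ ≤ diam K) :
    ∃ C ⊆ K, IsCompact C ∧ IsConnected C ∧ x ∈ C ∧ diam C = δ := by
  have hb : ∀ {C}, C ⊆ K → Bornology.IsBounded C := fun h => hKc.isBounded.subset h
  obtain ⟨C, -, hC⟩ := zorn_subset_nonempty
    {C : Set X | C ⊆ K ∧ IsClosed C ∧ IsPreconnected C ∧ x ∈ C ∧ diam C ≤ δ} (by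
      intro c hc hchain ⟨C₀, hC₀⟩
      refine ⟨closure (⋃₀ c), ⟨?_, isClosed_closure, ?_, ?_, ?_⟩, ?_⟩
      · exact closure_minimal (sUnion_subset fun C hC => (hc hC).1) hKc.isClosed
      · exact (isPreconnected_sUnion x c (fun C hC => (hc hC).2.2.2.1)
          (fun C hC => (hc hC).2.2.1)).closure
      · exact subset_closure ⟨C₀, hC₀, (hc hC₀).2.2.2.1⟩
      · rw [diam_closure]
        refine diam_le_of_forall_dist_le hδ ?_
        rintro y ⟨C, hC, hy⟩ z ⟨D, hD, hz⟩
        rcases hchain.total hC hD with h | h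
        · exact (dist_le_diam_of_mem (hb (hc hD).1) (h hy) hz).trans (hc hD).2.2.2.2
        · exact (dist_le_diam_of_mem (hb (hc hC).1) hy (h hz)).trans (hc hC).2.2.2.2
      · exact fun C hC => (subset_sUnion_of_mem hC).trans subset_closure)
    {x} ⟨by simpa using hx, isClosed_singleton, isPreconnected_singleton, rfl, by simpa using hδ⟩
  obtain ⟨⟨hCK, hCcl, hCp, hxC, hCδ⟩, hmax⟩ := hC
  refine ⟨C, hCK, hKc.of_isClosed_subset hCcl hCK, ⟨⟨x, hxC⟩, hCp⟩, hxC, ?_⟩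
  by_contra hne
  have hlt : diam C < δ := lt_of_le_of_ne hCδ hne
  have hCne : C.Nonempty := ⟨x, hxC⟩
  obtain ⟨η, hη, hηδ⟩ : ∃ η > 0, diam C + 2 * η < δ := ⟨(δ - diam C) / 3, by linarith, by linarith⟩
  have hclose : ∀ S : Set X, (∀ y ∈ S, infDist y C ≤ η) → diam S < δ := by
    intro S hS
    have : ∀ η' > η, diam S ≤ diam C + 2 * η' := by
      intro η' hη'
      refine diam_le_of_forall_dist_le (by linarith [diam_nonneg (s := C)]) fun y hy z hz => ?_
      obtain ⟨y', hy', hyy⟩ := (infDist_lt_iff hCne).mp ((hS y hy).trans_lt hη')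
      obtain ⟨z', hz', hzz⟩ := (infDist_lt_iff hCne).mp ((hS z hz).trans_lt hη')
      have h1 := dist_le_diam_of_mem (hb hCK) hy' hz'
      have h2 := dist_triangle4 y y' z' z
      rw [dist_comm z' z] at h2
      linarith
    have h := this ((η + (δ - diam C) / 2) / 2) (by linarith)
    linarith
  obtain ⟨z, hzK, hz⟩ : ∃ z ∈ K, η ≤ infDist z C := by
    by_contra! h
    exact absurd (hclose K fun y hy => (h y hy).le) (not_lt.mpr hδK)
  obtain ⟨D, hDK, hDc, hDp, hxD, hDη, y, hyD, hy⟩ :=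
    hK.exists_continuum_reaching_level hKc (continuous_infDist_pt C) hx
      (by rw [infDist_zero_of_mem hxC]; exact hη.le) hzK hz
  have hsub : C ∪ D ⊆ C := hmax ⟨union_subset hCK hDK, hCcl.union hDc.isClosed,
    hCp.union x hxC hxD hDp.isPreconnected, Or.inl hxC, (hclose _ (by
      rintro w (hw | hw)
      · rw [infDist_zero_of_mem hw]; exact hη.le
      · exact hDη w hw)).le⟩ subset_union_left
  rw [infDist_zero_of_mem (hsub (Or.inr hyD))] at hy
  exact hη.ne hy

namespace TopologicalSpace.NonemptyCompacts

theorem isClosed_setOf_diam_image_le {φ : X → X} (hφ : Continuous φ) {c : ℝ} (hc : 0 ≤ c) :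
    IsClosed {E : NonemptyCompacts X | diam (φ '' (E : Set X)) ≤ c} := by
  have h : IsClosed {p : X × X | dist (φ p.1) (φ p.2) ≤ c} :=
    isClosed_le (by fun_prop) continuous_const
  convert (isClosed_subsets_of_isClosed h).preimage
    (continuous_prod.comp (continuous_id.prodMk continuous_id)) using 1
  ext E
  constructor
  · rintro hE ⟨y, z⟩ ⟨hy, hz⟩
    exact (dist_le_diam_of_mem (E.isCompact.image hφ).isBounded (mem_image_of_mem φ hy)
      (mem_image_of_mem φ hz)).trans hE
  · rintro hE
    refine diam_le_of_forall_dist_le hc ?_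
    rintro _ ⟨y, hy, rfl⟩ _ ⟨z, hz, rfl⟩
    exact @hE (y, z) ⟨hy, hz⟩

theorem isClosed_setOf_le_diam {r : ℝ} :
    IsClosed {E : NonemptyCompacts X | r ≤ diam (E : Set X)} := by
  have h : IsOpen {p : X × X | dist p.1 p.2 < r} := isOpen_lt (by fun_prop) continuous_const
  rw [← isOpen_compl_iff]
  convert (isOpen_subsets_of_isOpen h).preimage
    (continuous_prod.comp (continuous_id.prodMk continuous_id)) using 1
  ext E
  constructor
  · rintro hE ⟨y, z⟩ ⟨hy, hz⟩
    exact (dist_le_diam_of_mem E.isCompact.isBounded hy hz).trans_lt (not_le.mp hE)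
  · rintro hE hr
    obtain ⟨⟨y, z⟩, hyz, hm⟩ := (E.isCompact.prod E.isCompact).exists_isMaxOn
      (E.nonempty.prod E.nonempty) (continuous_dist.continuousOn)
    have h1 : diam (E : Set X) ≤ dist y z :=
      diam_le_of_forall_dist_le dist_nonneg fun a ha b hb => hm (mk_mem_prod ha hb)
    have h2 : dist y z < r := @hE (y, z) hyz
    exact absurd (hr.trans h1) (not_le.mpr h2)

theorem isClosed_setOf_isConnected :
    IsClosed {E : NonemptyCompacts X | IsConnected (E : Set X)} := by
  rw [← isOpen_compl_iff, isOpen_iff_mem_nhds]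
  intro E hE
  have hE' : ¬ IsPreconnected (E : Set X) := fun h => hE ⟨E.nonempty, h⟩
  rw [isPreconnected_iff_subset_of_fully_disjoint_closed E.isCompact.isClosed] at hE'
  push Not at hE'
  obtain ⟨u, v, hu, hv, huv, hd, hEu, hEv⟩ := hE'
  obtain ⟨U, V, hU, hV, huU, hvV, hUV⟩ := normal_separation hu hv hd
  obtain ⟨a, haE, hau⟩ := not_subset.mp hEu
  obtain ⟨b, hbE, hbv⟩ := not_subset.mp hEv
  filter_upwards [(isOpen_subsets_of_isOpen (hU.union hV)).mem_nhds
      (huv.trans (union_subset_union huU hvV)),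
    (isOpen_inter_nonempty_of_isOpen hU).mem_nhds ⟨b, hbE, huU ((huv hbE).resolve_right hbv)⟩,
    (isOpen_inter_nonempty_of_isOpen hV).mem_nhds ⟨a, haE, hvV ((huv haE).resolve_left hau)⟩]
    with G h1 h2 h3 hG
  obtain ⟨w, -, hwU, hwV⟩ := hG.isPreconnected U V hU hV h1 h2 h3
  exact hUV.le_bot ⟨hwU, hwV⟩

end TopologicalSpace.NonemptyCompacts

theorem zim_eq_image (f : X ≃ₜ X) (j : ℤ) :
    ∃ φ : X → X, Continuous φ ∧ ∀ A, zim f j A = φ '' A := by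
  cases j with
  | ofNat n => exact ⟨f^[n], f.continuous.iterate n, fun _ => rfl⟩
  | negSucc n => exact ⟨f.symm^[n + 1], f.symm.continuous.iterate _, fun _ => rfl⟩

theorem zim_image_iterate (f : X ≃ₜ X) {j : ℤ} {m : ℕ} (h : 0 ≤ j + m) (A : Set X) :
    ∃ n : ℕ, zim f j (f^[m] '' A) = f^[n] '' A := by
  cases j with
  | ofNat a => exact ⟨a + m, by rw [Function.iterate_add, image_comp]; rfl⟩
  | negSucc a =>
    obtain ⟨k, rfl⟩ : ∃ k, m = (a + 1) + k := ⟨m - (a + 1), by omega⟩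
    refine ⟨k, ?_⟩
    change f.symm^[a + 1] '' _ = _
    have h : Function.LeftInverse f.symm f := f.symm_apply_apply
    rw [Function.iterate_add f, image_comp, (h.iterate (a + 1)).image_image]

/-- A stable continuum contains, through a point `x` far from some other of its points, a forward
bounded continuum which becomes large at some time. -/
theorem exists_forward_bounded_subcontinuum (f : X ≃ₜ X) {r : ℝ} (hr : 0 < r) {K : Set X}
    (hKc : IsCompact K) (hK : IsConnected K)
    (hst : Tendsto (fun n : ℕ => diam (f^[n] '' K)) atTop (nhds 0)) {x z : X} (hx : x ∈ K)
    (hz : z ∈ K) (hxz : r ≤ dist x z) :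
    ∃ C ⊆ K, IsCompact C ∧ IsConnected C ∧ x ∈ C ∧ (∀ n, diam (f^[n] '' C) ≤ 2 * r) ∧
      ∃ m, r ≤ diam (f^[m] '' C) := by
  obtain ⟨J, hJ⟩ := (hst.eventually_lt_const (show (0 : ℝ) < 2 * r by linarith)).exists_forall_of_atTop
  have hne : (Finset.range (J + 1)).Nonempty := ⟨0, by simp⟩
  have hle : ∀ {w : X} {n : ℕ}, n < J + 1 → dist (f^[n] x) (f^[n] w) ≤
      (Finset.range (J + 1)).sup' hne fun n => dist (f^[n] x) (f^[n] w) := fun {w n} hn =>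
    Finset.le_sup' (fun n => dist (f^[n] x) (f^[n] w)) (Finset.mem_range.mpr hn)
  obtain ⟨C, hCK, hCc, hC, hxC, hCr, y, hyC, hy⟩ :=
    hK.isPreconnected.exists_continuum_reaching_level hKc
    (g := fun w => (Finset.range (J + 1)).sup' hne fun n => dist (f^[n] x) (f^[n] w))
    (r := r) (Continuous.finset_sup'_apply hne fun n _ =>
      continuous_const.dist (f.continuous.iterate n)) hx (by simpa using hr.le) hz
    (hxz.trans (hle (n := 0) (by omega)))
  refine ⟨C, hCK, hCc, hC, hxC, fun n => ?_, ?_⟩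
  · rcases lt_or_ge n (J + 1) with hn | hn
    · refine diam_le_of_forall_dist_le (by linarith) ?_
      rintro _ ⟨a, ha, rfl⟩ _ ⟨b, hb, rfl⟩
      have h1 := dist_triangle_left (f^[n] a) (f^[n] b) (f^[n] x)
      have h2 := (hle hn).trans (hCr a ha)
      have h3 := (hle hn).trans (hCr b hb)
      linarith
    · exact (diam_mono (image_mono hCK)
        (hKc.image (f.continuous.iterate n)).isBounded).trans (hJ n (by omega)).le
  · obtain ⟨m, -, hm⟩ := Finset.exists_mem_eq_sup' hne fun n => dist (f^[n] x) (f^[n] y)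
    refine ⟨m, ?_⟩
    rw [← hy, hm]
    exact dist_le_diam_of_mem (hCc.image (f.continuous.iterate m)).isBounded
      (mem_image_of_mem _ hxC) (mem_image_of_mem _ hyC)

section CWExpansive

variable [CompactSpace X] {f : X ≃ₜ X} {δ : ℝ}

/-- Forward `δ`-bounded continua of a cw-expansive homeomorphism with constant `δ` contract
uniformly. -/
theorem exists_forall_diam_iterate_lt (hδ : 0 < δ)
    (hcw : ∀ A : Set X, IsConnected A → A.Nontrivial → ∃ n : ℤ, δ < diam (zim f n A))
    {r : ℝ} (hr : 0 < r) :
    ∃ N : ℕ, ∀ E : Set X, IsCompact E → IsConnected E → (∀ n, diam (f^[n] '' E) ≤ δ) →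
      ∀ m ≥ N, diam (f^[m] '' E) < r := by
  have hcpt : IsCompact ({E : NonemptyCompacts X | IsConnected (E : Set X)} ∩
      {E : NonemptyCompacts X | r ≤ diam (E : Set X)}) :=
    (NonemptyCompacts.isClosed_setOf_isConnected.inter
      NonemptyCompacts.isClosed_setOf_le_diam).isCompact
  obtain ⟨t, ht⟩ := hcpt.elim_finite_subcover
    (fun j : ℤ => {E : NonemptyCompacts X | diam (zim f j (E : Set X)) ≤ δ}ᶜ)
    (fun j => by
      obtain ⟨φ, hφ, h⟩ := zim_eq_image f j
      simp only [h]
      exact (NonemptyCompacts.isClosed_setOf_diam_image_le hφ hδ.le).isOpen_compl)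
    (fun E hE => by
      obtain ⟨n, hn⟩ := hcw E hE.1 (by
        by_contra h
        have h0 : diam (E : Set X) = 0 := diam_subsingleton (not_nontrivial_iff.mp h)
        exact absurd hE.2 (by simpa [h0] using hr))
      exact mem_iUnion.mpr ⟨n, not_le.mpr hn⟩)
  refine ⟨t.sup Int.natAbs, fun E hEc hE hfwd m hm => ?_⟩
  by_contra! hmr
  let G : NonemptyCompacts X := ⟨⟨f^[m] '' E, hEc.image (f.continuous.iterate m)⟩,
    hE.nonempty.image _⟩
  have hG : IsConnected (G : Set X) := hE.image _ (f.continuous.iterate m).continuousOn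
  obtain ⟨j, hjt, hj⟩ := mem_iUnion₂.mp (ht (show G ∈ _ from ⟨hG, hmr⟩))
  have hjm : j.natAbs ≤ m := (Finset.le_sup hjt).trans hm
  obtain ⟨n, hn⟩ := zim_image_iterate f (j := j) (m := m) (by omega) E
  exact hj (show diam (zim f j (f^[m] '' E)) ≤ δ from hn ▸ hfwd n)

/-- Forward `δ`-bounded continua which at some time have diameter at least `r` are uniformly
large. -/
theorem exists_forall_le_diam (hδ : 0 < δ)
    (hcw : ∀ A : Set X, IsConnected A → A.Nontrivial → ∃ n : ℤ, δ < diam (zim f n A))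
    {r : ℝ} (hr : 0 < r) :
    ∃ η > 0, ∀ E : Set X, IsCompact E → IsConnected E → (∀ n, diam (f^[n] '' E) ≤ δ) →
      (∃ m, r ≤ diam (f^[m] '' E)) → η ≤ diam E := by
  obtain ⟨N, hN⟩ := exists_forall_diam_iterate_lt hδ hcw hr
  have h : ∀ᶠ p : X × X in uniformity X, ∀ m ∈ Iio N, dist (f^[m] p.1) (f^[m] p.2) < r / 2 :=
    (eventually_all_finite (finite_Iio N)).mpr fun m _ =>
      (CompactSpace.uniformContinuous_of_continuous (f.continuous.iterate m))
        (dist_mem_uniformity (half_pos hr))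
  obtain ⟨η, hη, h⟩ := mem_uniformity_dist.mp h
  refine ⟨η, hη, fun E hEc hE hfwd ⟨m, hm⟩ => ?_⟩
  by_contra! hlt
  have hmN : m < N := by
    by_contra! hmN
    exact absurd (hN E hEc hE hfwd m hmN) (not_lt.mpr hm)
  have : diam (f^[m] '' E) ≤ r / 2 := by
    refine diam_le_of_forall_dist_le (half_pos hr).le ?_
    rintro _ ⟨y, hy, rfl⟩ _ ⟨z, hz, rfl⟩
    exact (h ((dist_le_diam_of_mem hEc.isBounded hy hz).trans_lt hlt) m hmN).le
  linarith

end CWExpansive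

/-- The backward iterates of a nontrivial stable continuum become dense. -/
theorem CondPA.eventually_forall_exists_dist_lt [CompactSpace X] {f : X ≃ₜ X} (hPA : CondPA f)
    {A : Continua X} (hA : A ∈ Ws f) (hnt : (A.1 : Set X).Nontrivial) {κ : ℝ} (hκ : 0 < κ) :
    ∀ᶠ n : ℕ in atTop, ∀ x : X, ∃ y ∈ f.symm^[n] '' (A.1 : Set X), dist y x < κ := by
  filter_upwards [(hPA.1 A hA hnt).eventually_lt_const hκ] with n hn x
  have hbdd : ∀ S : Set (Continua X), Bornology.IsBounded S := fun S => by
    have : IsCompact {E : NonemptyCompacts X | IsConnected (E : Set X)} :=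
      NonemptyCompacts.isClosed_setOf_isConnected.isCompact
    have : CompactSpace (Continua X) := isCompact_iff_compactSpace.mp this
    exact isCompact_univ.isBounded.subset (subset_univ S)
  let P : Continua X := ⟨{x}, by simpa using isConnected_singleton⟩
  have hP : P ∈ Ws f := by
    have : ∀ n : ℕ, diam (f^[n] '' (P.1 : Set X)) = 0 := fun n =>
      diam_subsingleton ((by simp [P] : (P.1 : Set X).Subsingleton).image _)
    simp only [Ws, mem_ofPred_eq, this]
    exact tendsto_const_nhds
  let B : Continua X := ⟨⟨⟨f.symm^[n] '' (A.1 : Set X),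
    A.1.isCompact.image (f.symm.continuous.iterate n)⟩, A.1.nonempty.image _⟩,
    A.2.image _ (f.symm.continuous.iterate n).continuousOn⟩
  obtain ⟨C, hC, hCP⟩ := exists_dist_lt_of_hausdorffDist_lt' (subset_closure hP) hn
    (hausdorffEDist_ne_top_of_nonempty_of_bounded
      ⟨B, (subset_rfl : (B.1 : Set X) ⊆ f.symm^[n] '' (A.1 : Set X))⟩
      ⟨P, subset_closure hP⟩ (hbdd _) (hbdd _))
  obtain ⟨y, hy⟩ := C.1.nonempty
  have hd : hausdorffDist (C.1 : Set X) {x} < κ := by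
    simpa [Subtype.dist_eq, NonemptyCompacts.dist_eq, P] using hCP
  obtain ⟨w, rfl, hw⟩ := exists_dist_lt_of_hausdorffDist_lt hy hd
    (hausdorffEDist_ne_top_of_nonempty_of_bounded C.1.nonempty (singleton_nonempty x)
      C.1.isCompact.isBounded Bornology.isBounded_singleton)
  exact ⟨y, hC hy, hw⟩

/-- For a cw-expansive homeomorphism of a continuum satisfying (PA): if there is
a stable continuum with more than one point, then there is δ > 0 such that every
point of X belongs to a stable continuum of diameter exactly δ. -/
theorem exists_uniform_stable_continua
    [CompactSpace X] [ConnectedSpace X] (f : X ≃ₜ X)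
    (hcw : IsCWExpansive f) (hPA : CondPA f)
    (hex : ∃ A : Continua X, A ∈ Ws f ∧ (A.1 : Set X).Nontrivial) :
    ∃ δ > 0, ∀ x : X, ∃ A : Continua X, A ∈ Ws f ∧
      Metric.diam (A.1 : Set X) = δ ∧ x ∈ (A.1 : Set X) := by
  obtain ⟨c, hc, hcw⟩ := hcw
  obtain ⟨A, hA, hnt⟩ := hex
  obtain ⟨a, -, b, -, hab⟩ := id hnt
  have hd : 0 < dist a b := dist_pos.mpr hab
  obtain ⟨r, hr, hrc, hrd⟩ : ∃ r > 0, 2 * r ≤ c ∧ r ≤ dist a b / 4 :=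
    ⟨min (c / 2) (dist a b / 4), by positivity,
      by linarith [min_le_left (c / 2) (dist a b / 4)], min_le_right _ _⟩
  obtain ⟨η, hη, hlarge⟩ := exists_forall_le_diam hc hcw hr
  have hcl : IsClosed ({E : NonemptyCompacts X | IsConnected (E : Set X)} ∩
      {E : NonemptyCompacts X | η ≤ diam (E : Set X)} ∩
      ⋂ n : ℕ, {E : NonemptyCompacts X | diam (f^[n] '' (E : Set X)) ≤ c}) :=
    (NonemptyCompacts.isClosed_setOf_isConnected.inter
      NonemptyCompacts.isClosed_setOf_le_diam).inter (isClosed_iInter fun n =>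
        NonemptyCompacts.isClosed_setOf_diam_image_le (f.continuous.iterate n) hc.le)
  have hcover := (NonemptyCompacts.isCompact_biUnion_coe_of_isCompact hcl.isCompact).isClosed
  have hmem : ∀ x : X, ∃ E : NonemptyCompacts X, (IsConnected (E : Set X) ∧
      η ≤ diam (E : Set X) ∧ ∀ n : ℕ, diam (f^[n] '' (E : Set X)) ≤ c) ∧ x ∈ E := by
    intro x
    have hx := hcover.closure_subset (Metric.mem_closure_iff (a := x).mpr fun κ hκ => by
      obtain ⟨n, hn⟩ := (hPA.eventually_forall_exists_dist_lt hA hnt (κ := min κ (dist a b / 4))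
        (by positivity)).exists
      set K := f.symm^[n] '' (A.1 : Set X) with hKdef
      have hKc : IsCompact K := A.1.isCompact.image (f.symm.continuous.iterate n)
      have hK : IsConnected K := A.2.image _ (f.symm.continuous.iterate n).continuousOn
      have hst : Tendsto (fun m : ℕ => diam (f^[m] '' K)) atTop (nhds 0) := by
        rw [← tendsto_add_atTop_iff_nat n]
        have h : Function.LeftInverse f f.symm := f.apply_symm_apply
        simp only [Function.iterate_add, image_comp, hKdef, (h.iterate n).image_image]
        exact hA
      obtain ⟨y, hyK, hy⟩ := hn x
      obtain ⟨a', haK, ha⟩ := hn a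
      obtain ⟨b', hbK, hb⟩ := hn b
      obtain ⟨z, hzK, hz⟩ : ∃ z ∈ K, r ≤ dist y z := by
        by_contra! h
        have h1 := h a' haK
        have h2 := h b' hbK
        have h3 := dist_triangle_left a' b' y
        have h4 := dist_triangle4 a a' b' b
        rw [dist_comm a a'] at h4
        have h5 := ha.trans_le (min_le_right _ _)
        have h6 := hb.trans_le (min_le_right _ _)
        linarith
      obtain ⟨C, -, hCc, hC, hyC, hCfwd, hCm⟩ :=
        exists_forward_bounded_subcontinuum f hr hKc hK hst hyK hzK hz
      have hfwd : ∀ n, diam (f^[n] '' C) ≤ c := fun n => (hCfwd n).trans hrc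
      refine ⟨y, mem_iUnion₂.mpr ⟨⟨⟨C, hCc⟩, hC.nonempty⟩,
        ⟨⟨hC, hlarge C hCc hC hfwd hCm⟩, mem_iInter.mpr hfwd⟩, hyC⟩, ?_⟩
      rw [dist_comm]
      exact hy.trans_le (min_le_left _ _))
    obtain ⟨E, ⟨⟨h1, h2⟩, h3⟩, hxE⟩ := mem_iUnion₂.mp hx
    exact ⟨E, ⟨h1, h2, fun n => mem_iInter.mp h3 n⟩, hxE⟩
  refine ⟨η, hη, fun x => ?_⟩
  obtain ⟨E, ⟨hE, hηE, hfwd⟩, hxE⟩ := hmem x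
  obtain ⟨C, hCE, hCc, hC, hxC, hCη⟩ :=
    hE.isPreconnected.exists_continuum_diam_eq E.isCompact hxE hη.le hηE
  refine ⟨⟨⟨⟨C, hCc⟩, hC.nonempty⟩, hC⟩, ?_, hCη, hxC⟩
  refine Metric.tendsto_atTop.mpr fun s hs => ?_
  obtain ⟨N, hN⟩ := exists_forall_diam_iterate_lt hc hcw hs
  refine ⟨N, fun m hm => ?_⟩
  rw [Real.dist_0_eq_abs, abs_of_nonneg diam_nonneg]
  exact hN C hCc hC (fun n => (diam_mono (image_mono hCE)
    (E.isCompact.image (f.continuous.iterate n)).isBounded).trans (hfwd n)) m hm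
end

section
/- Let f be a cw-expansive homeomorphism of a continuum X satisfying condition (PA), and suppose there exists a stable continuum with more than one point. Then for every x ∈ X the set CWˢ_f(x) = {y ∈ X : there is a stable continuum A with x, y ∈ A} is dense in X. The analogous statement holds for unstable continua: if there exists an unstable continuum with more than one point, then CWᵘ_f(x) = {y ∈ X : there is an unstable continuum A with x, y ∈ A} is dense in X for every x ∈ X. -/
open Metric Set Filter TopologicalSpace

variable {X : Type*} [MetricSpace X]

/-- The forward iterates of `S` have diameter tending to zero. -/
def IsStableSet (f : X ≃ₜ X) (S : Set X) : Prop :=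
  ∀ ε > 0, ∃ N : ℕ, ∀ n ≥ N, ∀ x ∈ S, ∀ y ∈ S, dist ((⇑f)^[n] x) ((⇑f)^[n] y) ≤ ε

/-- The forward iterates of `S` have diameter at most `δ`. -/
def IsForwardBounded (f : X ≃ₜ X) (δ : ℝ) (S : Set X) : Prop :=
  ∀ n : ℕ, ∀ x ∈ S, ∀ y ∈ S, dist ((⇑f)^[n] x) ((⇑f)^[n] y) ≤ δ

/-- `δ` is a cw-expansivity constant of `f`. -/
def IsCWConstant (f : X ≃ₜ X) (δ : ℝ) : Prop :=
  ∀ S : Set X, IsPreconnected S → IsForwardBounded f δ S → IsForwardBounded f.symm δ S →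
    S.Subsingleton

/-- The backward iterates of every nontrivial stable continuum become dense at every scale. -/
def HasDenseBackwardIterates (f : X ≃ₜ X) : Prop :=
  ∀ A : NonemptyCompacts X, IsPreconnected (A : Set X) → IsStableSet f A →
    (A : Set X).Nontrivial → ∀ ρ > 0, ∃ N : ℕ, ∀ n ≥ N, ∀ y : X, ∃ a ∈ A,
      dist y ((⇑f.symm)^[n] a) < ρ

section Hyperspace

theorem isClosed_setOf_isPreconnected :
    IsClosed {C : NonemptyCompacts X | IsPreconnected (C : Set X)} := by
  rw [← isOpen_compl_iff, isOpen_iff_forall_mem_open]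
  intro C hC
  have hC' : ¬ IsPreconnected (C : Set X) := hC
  rw [isPreconnected_iff_subset_of_disjoint_closed] at hC'
  push Not at hC'
  obtain ⟨u, v, hu, hv, hCuv, hdisj, hnu, hnv⟩ := hC'
  have hsep : SeparatedNhds ((C : Set X) ∩ u) ((C : Set X) ∩ v) := by
    refine SeparatedNhds.of_isCompact_isCompact (C.isCompact.inter_right hu)
      (C.isCompact.inter_right hv) ?_
    rw [Set.disjoint_left]
    rintro x ⟨hx, hxu⟩ ⟨-, hxv⟩
    have : x ∈ (C : Set X) ∩ (u ∩ v) := ⟨hx, hxu, hxv⟩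
    rw [hdisj] at this
    exact this
  obtain ⟨U, V, hU, hV, hCU, hCV, hUV⟩ := hsep
  refine ⟨{K | (K : Set X) ⊆ U ∪ V} ∩ ({K | ((K : Set X) ∩ U).Nonempty} ∩
    {K | ((K : Set X) ∩ V).Nonempty}), ?_, ?_, ?_, ?_, ?_⟩
  · rintro K ⟨hK, ⟨a, ha⟩, hb⟩ hpre
    have hKU := hpre.subset_left_of_subset_union hU hV hUV hK ⟨a, ha⟩
    obtain ⟨b, hb, hbV⟩ := hb
    exact Set.disjoint_left.1 hUV (hKU hb) hbV
  · exact (NonemptyCompacts.isOpen_subsets_of_isOpen (hU.union hV)).inter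
      ((NonemptyCompacts.isOpen_inter_nonempty_of_isOpen hU).inter
        (NonemptyCompacts.isOpen_inter_nonempty_of_isOpen hV))
  · intro x hx
    rcases hCuv hx with h | h
    · exact Or.inl (hCU ⟨hx, h⟩)
    · exact Or.inr (hCV ⟨hx, h⟩)
  · obtain ⟨x, hx, hxv⟩ := Set.not_subset.1 hnv
    have hxu := (hCuv hx).resolve_right hxv
    exact ⟨x, hx, hCU ⟨hx, hxu⟩⟩
  · obtain ⟨x, hx, hxu⟩ := Set.not_subset.1 hnu
    have hxv := (hCuv hx).resolve_left hxu
    exact ⟨x, hx, hCV ⟨hx, hxv⟩⟩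

theorem isClosed_setOf_forall_pair_le {g : X → X → ℝ} (hg : Continuous fun p : X × X => g p.1 p.2)
    (r : ℝ) : IsClosed {C : NonemptyCompacts X | ∀ x ∈ C, ∀ y ∈ C, g x y ≤ r} := by
  have h := (NonemptyCompacts.isClosed_subsets_of_isClosed
    (isClosed_le hg (continuous_const (y := r)))).preimage
    (NonemptyCompacts.continuous_prod.comp
      (continuous_id.prodMk (continuous_id (X := NonemptyCompacts X))))
  convert! h using 1
  ext C
  constructor
  · rintro h ⟨x, y⟩ ⟨hx, hy⟩
    exact h x hx y hy
  · intro h x hx y hy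
    exact h (show (x, y) ∈ (C : Set X) ×ˢ (C : Set X) from ⟨hx, hy⟩)

theorem isClosed_setOf_exists_pair_ge {g : X → X → ℝ} (hg : Continuous fun p : X × X => g p.1 p.2)
    (r : ℝ) : IsClosed {C : NonemptyCompacts X | ∃ x ∈ C, ∃ y ∈ C, r ≤ g x y} := by
  have h := (NonemptyCompacts.isClosed_inter_nonempty_of_isClosed
    (isClosed_le (continuous_const (y := r)) hg)).preimage
    (NonemptyCompacts.continuous_prod.comp
      (continuous_id.prodMk (continuous_id (X := NonemptyCompacts X))))
  convert! h using 1
  ext C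
  constructor
  · rintro ⟨x, hx, y, hy, h⟩
    exact ⟨(x, y), ⟨hx, hy⟩, h⟩
  · rintro ⟨⟨x, y⟩, ⟨hx, hy⟩, h⟩
    exact ⟨x, hx, y, hy, h⟩

theorem isClosed_setOf_isForwardBounded (f : X ≃ₜ X) (δ : ℝ) :
    IsClosed {C : NonemptyCompacts X | IsForwardBounded f δ C} := by
  simp only [IsForwardBounded, Set.ofPred_forall]
  refine isClosed_iInter fun n => ?_
  have := f.continuous.iterate n
  have h := isClosed_setOf_forall_pair_le
    (g := fun x y => dist ((⇑f)^[n] x) ((⇑f)^[n] y)) (by fun_prop) δ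
  simpa only [Set.ofPred_forall] using! h

end Hyperspace

/-- Boundary bumping: a continuum which escapes a sublevel set of a continuous function contains,
through each point of the open sublevel set, a subcontinuum reaching the boundary. -/
theorem exists_subcontinuum_reaching_level {B : Set X} (hBc : IsCompact B) (hB : IsPreconnected B)
    {φ : X → ℝ} (hφ : Continuous φ) {r : ℝ} {p q : X} (hp : p ∈ B) (hpr : φ p < r) (hq : q ∈ B)
    (hqr : r ≤ φ q) :
    ∃ C : NonemptyCompacts X, (C : Set X) ⊆ B ∧ IsPreconnected (C : Set X) ∧ p ∈ C ∧
      (∀ x ∈ C, φ x ≤ r) ∧ ∃ z ∈ C, r ≤ φ z := by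
  set S : Set X := B ∩ {x | φ x ≤ r}
  have hSc : IsCompact S := hBc.inter_right (isClosed_le hφ continuous_const)
  have : CompactSpace S := isCompact_iff_compactSpace.1 hSc
  set p' : S := ⟨p, hp, hpr.le⟩
  have hcc : IsCompact (connectedComponent p') := isClosed_connectedComponent.isCompact
  refine ⟨⟨⟨Subtype.val '' connectedComponent p', hcc.image continuous_subtype_val⟩,
    ⟨p, p', mem_connectedComponent, rfl⟩⟩, ?_, ?_, ?_, ?_, ?_⟩
  · rintro _ ⟨x, -, rfl⟩
    exact x.2.1
  · exact isPreconnected_connectedComponent.image _ continuous_subtype_val.continuousOn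
  · exact ⟨p', mem_connectedComponent, rfl⟩
  · rintro _ ⟨x, -, rfl⟩
    exact x.2.2
  by_contra hno
  have hlt : connectedComponent p' ⊆ {x : S | φ x < r} := by
    intro x hx
    by_contra hx'
    exact hno ⟨x, ⟨x, hx, rfl⟩, not_lt.1 hx'⟩
  have hopen : IsOpen {x : S | φ x < r} :=
    isOpen_lt (hφ.comp continuous_subtype_val) continuous_const
  rw [connectedComponent_eq_iInter_isClopen] at hlt
  have : Nonempty {s : Set S // IsClopen s ∧ p' ∈ s} := ⟨⟨univ, isClopen_univ, mem_univ _⟩⟩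
  obtain ⟨⟨Z, hZ, hpZ⟩, hZlt⟩ := exists_subset_nhds_of_isCompact'
    (V := fun s : {s : Set S // IsClopen s ∧ p' ∈ s} => (s : Set S))
    (fun s t => ⟨⟨s.1 ∩ t.1, s.2.1.inter t.2.1, s.2.2, t.2.2⟩, inter_subset_left,
      inter_subset_right⟩)
    (fun s => s.2.1.isClosed.isCompact)
    (fun s => s.2.1.isClosed) (U := {x : S | φ x < r})
    (fun x hx => hopen.mem_nhds (hlt hx))
  obtain ⟨O, hO, rfl⟩ := isOpen_induced_iff.1 hZ.isOpen
  have hclosed : IsClosed (Subtype.val '' (Subtype.val ⁻¹' O : Set S)) :=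
    (hZ.isClosed.isCompact.image continuous_subtype_val).isClosed
  obtain ⟨x, hxB, ⟨hxO, hxr⟩, hx⟩ := hB (O ∩ {x | φ x < r})
    (Subtype.val '' (Subtype.val ⁻¹' O : Set S))ᶜ
    (hO.inter (isOpen_lt hφ continuous_const)) hclosed.isOpen_compl
    (by
      intro x hx
      by_cases h : x ∈ Subtype.val '' (Subtype.val ⁻¹' O : Set S)
      · left
        obtain ⟨y, hy, rfl⟩ := h
        exact ⟨hy, hZlt hy⟩
      · exact Or.inr h)
    ⟨p, hp, hpZ, hpr⟩
    ⟨q, hq, by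
      rintro ⟨y, hy, rfl⟩
      exact absurd (hZlt hy) (not_lt.2 hqr)⟩
  exact hx ⟨⟨x, hxB, (show φ x < r from hxr).le⟩, hxO, rfl⟩

theorem IsStableSet.mono {f : X ≃ₜ X} {S T : Set X} (hT : IsStableSet f T) (h : S ⊆ T) :
    IsStableSet f S := fun ε hε =>
  let ⟨N, hN⟩ := hT ε hε
  ⟨N, fun n hn x hx y hy => hN n hn x (h hx) y (h hy)⟩

theorem iterate_symm_iterate_add (f : X ≃ₜ X) (m n : ℕ) (x : X) :
    (⇑f)^[m + n] ((⇑f.symm)^[n] x) = (⇑f)^[m] x := by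
  rw [Function.iterate_add_apply,
    (Function.LeftInverse.iterate f.apply_symm_apply n : Function.LeftInverse (⇑f)^[n] _) x]

theorem IsStableSet.image_symm_iterate {f : X ≃ₜ X} {S : Set X} (hS : IsStableSet f S) (m : ℕ) :
    IsStableSet f ((⇑f.symm)^[m] '' S) := by
  intro ε hε
  obtain ⟨N, hN⟩ := hS ε hε
  refine ⟨N + m, ?_⟩
  rintro n hn _ ⟨x, hx, rfl⟩ _ ⟨y, hy, rfl⟩
  obtain ⟨k, rfl⟩ := Nat.exists_eq_add_of_le' (le_trans (Nat.le_add_left m N) hn)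
  rw [iterate_symm_iterate_add, iterate_symm_iterate_add]
  exact hN k (by omega) x hx y hy

theorem IsStableSet.union {f : X ≃ₜ X} {S T : Set X} (hS : IsStableSet f S)
    (hT : IsStableSet f T) {p : X} (hpS : p ∈ S) (hpT : p ∈ T) : IsStableSet f (S ∪ T) := by
  intro ε hε
  obtain ⟨N, hN⟩ := hS (ε / 2) (half_pos hε)
  obtain ⟨M, hM⟩ := hT (ε / 2) (half_pos hε)
  refine ⟨max N M, fun n hn => ?_⟩
  have key : ∀ x ∈ S ∪ T, dist ((⇑f)^[n] x) ((⇑f)^[n] p) ≤ ε / 2 := by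
    rintro x (hx | hx)
    · exact hN n (le_trans (le_max_left _ _) hn) x hx p hpS
    · exact hM n (le_trans (le_max_right _ _) hn) x hx p hpT
  intro x hx y hy
  have := dist_triangle_right ((⇑f)^[n] x) ((⇑f)^[n] y) ((⇑f)^[n] p)
  linarith [key x hx, key y hy]

theorem mem_Ws_iff {f : X ≃ₜ X} {A : Continua X} : A ∈ Ws f ↔ IsStableSet f (A.1 : Set X) := by
  have hbdd : ∀ n, Bornology.IsBounded ((⇑f)^[n] '' (A.1 : Set X)) := fun n =>
    (A.1.isCompact.image (f.continuous.iterate n)).isBounded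
  constructor
  · intro h ε hε
    obtain ⟨N, hN⟩ := eventually_atTop.1 ((tendsto_order.1 h).2 ε hε)
    exact ⟨N, fun n hn x hx y hy => (Metric.dist_le_diam_of_mem (hbdd n)
      (mem_image_of_mem _ hx) (mem_image_of_mem _ hy)).trans (hN n hn).le⟩
  · intro h
    refine Metric.tendsto_atTop.2 fun ε hε => ?_
    obtain ⟨N, hN⟩ := h (ε / 2) (half_pos hε)
    refine ⟨N, fun n hn => ?_⟩
    rw [Real.dist_eq, sub_zero, abs_of_nonneg Metric.diam_nonneg]
    refine (Metric.diam_le_of_forall_dist_le (half_pos hε).le ?_).trans_lt (half_lt_self hε)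
    rintro _ ⟨x, hx, rfl⟩ _ ⟨y, hy, rfl⟩
    exact hN n hn x hx y hy

theorem IsForwardBounded.diam_image_le {f : X ≃ₜ X} {δ : ℝ} (hδ : 0 ≤ δ) {S : Set X}
    (hS : IsForwardBounded f δ S) (n : ℕ) : Metric.diam ((⇑f)^[n] '' S) ≤ δ := by
  refine Metric.diam_le_of_forall_dist_le hδ ?_
  rintro _ ⟨x, hx, rfl⟩ _ ⟨y, hy, rfl⟩
  exact hS n x hx y hy

theorem IsCWExpansive.exists_isCWConstant {f : X ≃ₜ X} (h : IsCWExpansive f) :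
    ∃ δ > 0, IsCWConstant f δ := by
  obtain ⟨δ, hδ, h⟩ := h
  refine ⟨δ, hδ, fun S hS hf hb => ?_⟩
  by_contra hnt
  rw [Set.not_subsingleton_iff] at hnt
  obtain ⟨n, hn⟩ := h S ⟨hnt.nonempty, hS⟩ hnt
  cases n with
  | ofNat n => exact absurd hn (not_lt.2 (hf.diam_image_le hδ.le n))
  | negSucc n => exact absurd hn (not_lt.2 (hb.diam_image_le hδ.le (n + 1)))

theorem IsCWConstant.symm {f : X ≃ₜ X} {δ : ℝ} (h : IsCWConstant f δ) : IsCWConstant f.symm δ :=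
  fun S hS hf hb => h S hS hb hf

section Compact

variable [CompactSpace X]

theorem IsCWConstant.exists_bound {f : X ≃ₜ X} {δ : ℝ} (hδ : IsCWConstant f δ) {η : ℝ}
    (hη : 0 < η) :
    ∃ N : ℕ, ∀ C : NonemptyCompacts X, IsPreconnected (C : Set X) →
      (∀ n ≤ N, ∀ x ∈ C, ∀ y ∈ C, dist ((⇑f)^[n] x) ((⇑f)^[n] y) ≤ δ) →
      (∀ n ≤ N, ∀ x ∈ C, ∀ y ∈ C, dist ((⇑f.symm)^[n] x) ((⇑f.symm)^[n] y) ≤ δ) →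
      ∀ x ∈ C, ∀ y ∈ C, dist x y < η := by
  by_contra! hcon
  have hcl : ∀ g : X ≃ₜ X, ∀ N : ℕ, IsClosed {C : NonemptyCompacts X | ∀ n ≤ N,
      ∀ x ∈ C, ∀ y ∈ C, dist ((⇑g)^[n] x) ((⇑g)^[n] y) ≤ δ} := by
    intro g N
    have : {C : NonemptyCompacts X | ∀ n ≤ N,
      ∀ x ∈ C, ∀ y ∈ C, dist ((⇑g)^[n] x) ((⇑g)^[n] y) ≤ δ} = ⋂ n ≤ N, {C |
      ∀ x ∈ C, ∀ y ∈ C, dist ((⇑g)^[n] x) ((⇑g)^[n] y) ≤ δ} := by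
      ext; simp
    rw [this]
    refine isClosed_biInter fun n _ => ?_
    have := g.continuous.iterate n
    exact isClosed_setOf_forall_pair_le
      (g := fun x y => dist ((⇑g)^[n] x) ((⇑g)^[n] y)) (by fun_prop) δ
  let t : ℕ → Set (NonemptyCompacts X) := fun N =>
    ({C | IsPreconnected (C : Set X)} ∩ {C | ∃ x ∈ C, ∃ y ∈ C, η ≤ dist x y}) ∩
    ({C | ∀ n ≤ N, ∀ x ∈ C, ∀ y ∈ C, dist ((⇑f)^[n] x) ((⇑f)^[n] y) ≤ δ} ∩
     {C | ∀ n ≤ N, ∀ x ∈ C, ∀ y ∈ C, dist ((⇑f.symm)^[n] x) ((⇑f.symm)^[n] y) ≤ δ})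
  have htc : ∀ N, IsClosed (t N) := fun N =>
    (isClosed_setOf_isPreconnected.inter
      (isClosed_setOf_exists_pair_ge continuous_dist η)).inter ((hcl f N).inter (hcl f.symm N))
  obtain ⟨C, hC⟩ := IsCompact.nonempty_iInter_of_sequence_nonempty_isCompact_isClosed t
    (fun N C hC => ⟨hC.1, fun n hn => hC.2.1 n (by omega), fun n hn => hC.2.2 n (by omega)⟩)
    (fun N => by
      obtain ⟨C, h1, h2, h3, h4⟩ := hcon N
      exact ⟨C, ⟨h1, h4⟩, h2, h3⟩)
    (htc 0).isCompact htc
  rw [mem_iInter] at hC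
  obtain ⟨x, hx, y, hy, hxy⟩ := (hC 0).1.2
  have := hδ C (hC 0).1.1 (fun n => (hC n).2.1 n le_rfl) (fun n => (hC n).2.2 n le_rfl) hx hy
  rw [this, dist_self] at hxy
  linarith

/-- The finite-time criterion of `IsCWConstant.exists_bound`, applied to forward iterates. -/
theorem IsCWConstant.exists_bound_iterate {f : X ≃ₜ X} {δ : ℝ} (hδ : IsCWConstant f δ) {η : ℝ}
    (hη : 0 < η) :
    ∃ N : ℕ, ∀ C : NonemptyCompacts X, IsPreconnected (C : Set X) → IsForwardBounded f δ C →
      ∀ n ≥ N, ∀ x ∈ C, ∀ y ∈ C, dist ((⇑f)^[n] x) ((⇑f)^[n] y) < η := by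
  obtain ⟨N, hN⟩ := hδ.exists_bound hη
  refine ⟨N, fun C hC hbd n hn x hx y hy => ?_⟩
  have hcont := f.continuous.iterate n
  refine hN (C.map _ hcont) ?_ ?_ ?_ _ ⟨x, hx, rfl⟩ _ ⟨y, hy, rfl⟩
  · rw [NonemptyCompacts.coe_map]
    exact hC.image _ hcont.continuousOn
  · rintro m - _ ⟨x, hx, rfl⟩ _ ⟨y, hy, rfl⟩
    rw [← Function.iterate_add_apply, ← Function.iterate_add_apply]
    exact hbd _ x hx y hy
  · rintro m hm _ ⟨x, hx, rfl⟩ _ ⟨y, hy, rfl⟩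
    obtain ⟨k, rfl⟩ := Nat.exists_eq_add_of_le (hm.trans hn)
    have hinv : ∀ z, (⇑f.symm)^[m] ((⇑f)^[m + k] z) = (⇑f)^[k] z := fun z => by
      rw [Function.iterate_add_apply,
        (Function.LeftInverse.iterate f.symm_apply_apply m : Function.LeftInverse _ (⇑f)^[m]) _]
    rw [hinv, hinv]
    exact hbd _ x hx y hy

theorem IsForwardBounded.isStableSet {f : X ≃ₜ X} {δ : ℝ} {C : NonemptyCompacts X}
    (hbd : IsForwardBounded f δ C) (hδ : IsCWConstant f δ) (hC : IsPreconnected (C : Set X)) :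
    IsStableSet f C := by
  intro ε hε
  obtain ⟨N, hN⟩ := hδ.exists_bound_iterate hε
  exact ⟨N, fun n hn x hx y hy => (hN C hC hbd n hn x hx y hy).le⟩

/-- Sufficiently small stable continua stay small under all forward iterates. -/
theorem IsCWConstant.exists_isForwardBounded {f : X ≃ₜ X} {δ : ℝ} (hδ : IsCWConstant f δ)
    (hδ0 : 0 < δ) :
    ∃ η > 0, ∀ B : NonemptyCompacts X, IsPreconnected (B : Set X) → IsStableSet f B →
      (∀ x ∈ B, ∀ y ∈ B, dist x y < η) → IsForwardBounded f δ B := by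
  obtain ⟨N, hN⟩ := hδ.exists_bound_iterate (half_pos hδ0)
  have huc : ∀ᶠ p in uniformity X, ∀ n ∈ Finset.range N,
      dist ((⇑f)^[n] p.1) ((⇑f)^[n] p.2) < δ / 2 := by
    rw [Filter.eventually_all_finset]
    intro n _
    exact CompactSpace.uniformContinuous_of_continuous (f.continuous.iterate n)
      (Metric.dist_mem_uniformity (half_pos hδ0))
  obtain ⟨η, hη, hηN⟩ := Metric.mem_uniformity_dist.1 huc
  refine ⟨η, hη, fun B hB hst hsmall n₀ x₀ hx₀ y₀ hy₀ => ?_⟩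
  by_contra! hlarge
  obtain ⟨N₁, hN₁⟩ := hst δ hδ0
  have hne : (Finset.range (N₁ + n₀ + 1)).Nonempty := ⟨0, by simp⟩
  let φ : X → ℝ := fun y => (Finset.range (N₁ + n₀ + 1)).sup' hne fun n =>
    dist ((⇑f)^[n] x₀) ((⇑f)^[n] y)
  have hφ : Continuous φ := Continuous.finset_sup'_apply hne fun n _ => by
    have := f.continuous.iterate n
    fun_prop
  obtain ⟨C, hCB, hC, hxC, hCle, z, hz, hzge⟩ := exists_subcontinuum_reaching_level
    (r := δ / 2) B.isCompact hB hφ hx₀ (by simp [φ, half_pos hδ0]) hy₀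
    ((half_lt_self hδ0).le.trans (hlarge.le.trans
      (Finset.le_sup' (fun n => dist ((⇑f)^[n] x₀) ((⇑f)^[n] y₀))
        (by simp : n₀ ∈ Finset.range (N₁ + n₀ + 1)))))
  have hbd : IsForwardBounded f δ C := by
    intro n x hx y hy
    by_cases hn : N₁ ≤ n
    · exact hN₁ n hn x (hCB hx) y (hCB hy)
    · have hmem : n ∈ Finset.range (N₁ + n₀ + 1) := by
        rw [Finset.mem_range]
        omega
      have h1 := (Finset.sup'_le_iff _ _).1 (hCle x hx) n hmem
      have h2 := (Finset.sup'_le_iff _ _).1 (hCle y hy) n hmem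
      have := dist_triangle_left ((⇑f)^[n] x) ((⇑f)^[n] y) ((⇑f)^[n] x₀)
      linarith
  obtain ⟨n, -, hn⟩ := (Finset.le_sup'_iff _).1 hzge
  by_cases hnN : n < N
  · exact absurd (hηN (hsmall x₀ hx₀ z (hCB hz)) n (Finset.mem_range.2 hnN)) (not_lt.2 hn)
  · exact absurd (hN C hC hbd n (not_lt.1 hnN) x₀ hxC z hz) (not_lt.2 hn)

/-- There is a closed family of nontrivial stable continua that covers the space. -/
theorem HasDenseBackwardIterates.exists_isClosed_stable_cover {f : X ≃ₜ X} {δ : ℝ}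
    (hd : HasDenseBackwardIterates f) (hδ : IsCWConstant f δ) (hδ0 : 0 < δ)
    {A : NonemptyCompacts X} (hA : IsPreconnected (A : Set X)) (hst : IsStableSet f A)
    (hnt : (A : Set X).Nontrivial) :
    ∃ 𝒦 : Set (NonemptyCompacts X), IsClosed 𝒦 ∧ (∀ C ∈ 𝒦, IsPreconnected (C : Set X) ∧
      IsStableSet f C ∧ (C : Set X).Nontrivial) ∧ ∀ p, ∃ C ∈ 𝒦, p ∈ C := by
  obtain ⟨η, hη, hsmall⟩ := hδ.exists_isForwardBounded hδ0
  obtain ⟨a, -, b, -, hab⟩ := id hnt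
  have hab' := dist_pos.2 hab
  obtain ⟨s, hs0, hsη, hsab⟩ : ∃ s > 0, 2 * s < η ∧ 4 * s ≤ dist a b :=
    ⟨min (η / 3) (dist a b / 4), by positivity,
      by linarith [min_le_left (η / 3) (dist a b / 4)],
      by linarith [min_le_right (η / 3) (dist a b / 4)]⟩
  let 𝒦 : Set (NonemptyCompacts X) := ({C | IsPreconnected (C : Set X)} ∩
    {C | IsForwardBounded f δ C}) ∩ {C | ∃ x ∈ C, ∃ y ∈ C, s ≤ dist x y}
  have h𝒦 : IsClosed 𝒦 := (isClosed_setOf_isPreconnected.inter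
    (isClosed_setOf_isForwardBounded f δ)).inter (isClosed_setOf_exists_pair_ge continuous_dist s)
  refine ⟨𝒦, h𝒦, ?_, ?_⟩
  · rintro C ⟨⟨hC, hbd⟩, x, hx, y, hy, hxy⟩
    exact ⟨hC, hbd.isStableSet hδ hC, x, hx, y, hy, dist_pos.1 (hs0.trans_le hxy)⟩
  have hcl : IsClosed (⋃ C ∈ 𝒦, (C : Set X)) :=
    (NonemptyCompacts.isCompact_biUnion_coe_of_isCompact h𝒦.isCompact).isClosed
  suffices hdense : Dense (⋃ C ∈ 𝒦, (C : Set X)) by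
    intro p
    have hp : p ∈ ⋃ C ∈ 𝒦, (C : Set X) := by
      rw [← hcl.closure_eq]
      exact hdense p
    simpa using hp
  rw [Metric.dense_iff]
  intro y ρ hρ
  obtain ⟨N, hN⟩ := hd A hA hst hnt (min ρ s) (by positivity)
  obtain ⟨p', hp', hyp⟩ := hN N le_rfl y
  have hcont := f.symm.continuous.iterate N
  have hfar : ∃ q ∈ A, s ≤ dist ((⇑f.symm)^[N] p') ((⇑f.symm)^[N] q) := by
    obtain ⟨u, hu, hua⟩ := hN N le_rfl a
    obtain ⟨v, hv, hvb⟩ := hN N le_rfl b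
    by_contra! hcon
    have h1 := hcon u hu
    have h2 := hcon v hv
    have h3 := min_le_right ρ s
    have h4 := dist_triangle4 a ((⇑f.symm)^[N] u) ((⇑f.symm)^[N] v) b
    have h5 := dist_triangle_left ((⇑f.symm)^[N] u) ((⇑f.symm)^[N] v) ((⇑f.symm)^[N] p')
    rw [dist_comm b] at hvb
    linarith
  obtain ⟨q', hq', hpq⟩ := hfar
  obtain ⟨C, hCB, hC, hpC, hCle, z, hz, hzge⟩ := exists_subcontinuum_reaching_level
    (A.isCompact.image hcont) (hA.image _ hcont.continuousOn)
    (φ := fun x => dist ((⇑f.symm)^[N] p') x) (by fun_prop) (r := s)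
    (mem_image_of_mem _ hp') (by simpa using hs0) (mem_image_of_mem _ hq') hpq
  refine ⟨(⇑f.symm)^[N] p', ?_, ?_⟩
  · rw [Metric.mem_ball, dist_comm]
    exact hyp.trans_le (min_le_left _ _)
  · refine mem_biUnion (x := C) ⟨⟨hC, ?_⟩, _, hpC, z, hz, hzge⟩ hpC
    refine hsmall C hC ((hst.image_symm_iterate N).mono hCB) fun x hx y hy => ?_
    have := dist_triangle_left x y ((⇑f.symm)^[N] p')
    linarith [hCle x hx, hCle y hy]

/-- Some stable continuum through `x` comes within `ε` of `y`. -/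
theorem HasDenseBackwardIterates.exists_stable_near {f : X ≃ₜ X} {δ : ℝ}
    (hd : HasDenseBackwardIterates f) (hδ : IsCWConstant f δ) (hδ0 : 0 < δ)
    {A : NonemptyCompacts X} (hA : IsPreconnected (A : Set X)) (hst : IsStableSet f A)
    (hnt : (A : Set X).Nontrivial) (x y : X) {ε : ℝ} (hε : 0 < ε) :
    ∃ C : NonemptyCompacts X, IsPreconnected (C : Set X) ∧ IsStableSet f C ∧ x ∈ C ∧
      ∃ z ∈ C, dist y z ≤ ε := by
  obtain ⟨𝒦, h𝒦, hprop, hcov⟩ := hd.exists_isClosed_stable_cover hδ hδ0 hA hst hnt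
  have : Nonempty X := ⟨x⟩
  let F : ℕ → Set (NonemptyCompacts X) := fun N => 𝒦 ∩
    ⋂ n ≥ N, {C | ((C : Set X) ∩ {c | dist y ((⇑f.symm)^[n] c) ≤ ε}).Nonempty}
  have hF : ∀ N, IsClosed (F N) := fun N => h𝒦.inter <| isClosed_biInter fun n _ => by
    have := f.symm.continuous.iterate n
    exact NonemptyCompacts.isClosed_inter_nonempty_of_isClosed
      (isClosed_le (by fun_prop) continuous_const)
  obtain ⟨N, p₀, hp₀⟩ := nonempty_interior_of_iUnion_of_closed
    (f := fun N => ⋃ C ∈ F N, (C : Set X))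
    (fun N => (NonemptyCompacts.isCompact_biUnion_coe_of_isCompact (hF N).isCompact).isClosed)
    (by
      refine eq_univ_of_forall fun p => ?_
      obtain ⟨C, hC, hpC⟩ := hcov p
      obtain ⟨hC1, hC2, hC3⟩ := hprop C hC
      obtain ⟨N, hN⟩ := hd C hC1 hC2 hC3 ε hε
      refine mem_iUnion.2 ⟨N, mem_biUnion (x := C) ⟨hC, mem_iInter₂.2 fun n hn => ?_⟩ hpC⟩
      obtain ⟨c, hc, hyc⟩ := hN n hn y
      exact ⟨c, hc, hyc.le⟩)
  set U := interior (⋃ C ∈ F N, (C : Set X))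
  have hUo : IsOpen U := isOpen_interior
  obtain ⟨M, hM⟩ := h𝒦.isCompact.elim_directed_cover
    (fun M : ℕ => ⋃ k ≤ M,
      {C : NonemptyCompacts X | ((C : Set X) ∩ (⇑f.symm)^[k] ⁻¹' U).Nonempty})
    (fun M => isOpen_biUnion fun k _ => NonemptyCompacts.isOpen_inter_nonempty_of_isOpen
      (hUo.preimage (f.symm.continuous.iterate k)))
    (by
      intro C hC
      obtain ⟨hC1, hC2, hC3⟩ := hprop C hC
      obtain ⟨ρ, hρ, hball⟩ := Metric.isOpen_iff.1 hUo p₀ hp₀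
      obtain ⟨k, hk⟩ := hd C hC1 hC2 hC3 ρ hρ
      obtain ⟨c, hc, hcd⟩ := hk k le_rfl p₀
      rw [dist_comm] at hcd
      exact mem_iUnion.2 ⟨k, mem_biUnion (x := k) (show k ≤ k from le_rfl) ⟨c, hc, hball hcd⟩⟩)
    (Monotone.directed_le fun a b hab =>
      biUnion_mono (fun k hk => le_trans hk hab) fun _ _ => le_rfl)
  obtain ⟨C, hC, hxC⟩ := hcov ((⇑f)^[M + N] x)
  obtain ⟨k, hk, c, hc, hcU⟩ := mem_iUnion₂.1 (hM hC)
  obtain ⟨D, hD, hcD⟩ := mem_iUnion₂.1 (interior_subset hcU)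
  obtain ⟨j, hj⟩ := Nat.exists_eq_add_of_le' (le_trans hk (Nat.le_add_right M N))
  obtain ⟨hC1, hC2, -⟩ := hprop C hC
  obtain ⟨hD1, hD2, -⟩ := hprop D hD.1
  obtain ⟨z, hz, hyz⟩ := mem_iInter₂.1 hD.2 j (by simp only [ge_iff_le]; omega)
  have hcontC := f.symm.continuous.iterate (M + N)
  have hcontD := f.symm.continuous.iterate j
  have hmemC : (⇑f.symm)^[M + N] c ∈ (⇑f.symm)^[M + N] '' (C : Set X) := mem_image_of_mem _ hc
  have hmemD : (⇑f.symm)^[M + N] c ∈ (⇑f.symm)^[j] '' (D : Set X) :=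
    ⟨_, hcD, by rw [← Function.iterate_add_apply, hj]⟩
  refine ⟨C.map _ hcontC ⊔ D.map _ hcontD, ?_, ?_, Or.inl ⟨_, hxC, ?_⟩,
    _, Or.inr ⟨z, hz, rfl⟩, hyz⟩
  · rw [NonemptyCompacts.coe_sup, NonemptyCompacts.coe_map, NonemptyCompacts.coe_map]
    exact (hC1.image _ hcontC.continuousOn).union _ hmemC hmemD
      (hD1.image _ hcontD.continuousOn)
  · rw [NonemptyCompacts.coe_sup, NonemptyCompacts.coe_map, NonemptyCompacts.coe_map]
    exact (hC2.image_symm_iterate _).union (hD2.image_symm_iterate _) hmemC hmemD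
  · exact (f.left_inv.iterate (M + N) : Function.LeftInverse _ _) x

/-- The part of condition (PA) on stable continua forces dense backward iterates, since singletons
are stable. -/
theorem hasDenseBackwardIterates_of_tendsto {f : X ≃ₜ X}
    (h : ∀ A : Continua X, A ∈ Ws f → (A.1 : Set X).Nontrivial →
      Tendsto (fun n : ℕ =>
        hausdorffDist {B : Continua X | (B.1 : Set X) ⊆ (⇑f.symm)^[n] '' (A.1 : Set X)}
          (closure (Ws f))) atTop (nhds 0)) :
    HasDenseBackwardIterates f := by
  intro A hA hst hnt ρ hρ
  obtain ⟨N, hN⟩ := eventually_atTop.1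
    ((tendsto_order.1 (h ⟨A, A.nonempty, hA⟩ (mem_Ws_iff.2 hst) hnt)).2 ρ hρ)
  refine ⟨N, fun n hn y => ?_⟩
  have single : ∀ z : X, IsConnected (({z} : NonemptyCompacts X) : Set X) := fun z => by
    rw [NonemptyCompacts.coe_singleton]
    exact isConnected_singleton
  have hbdd : ∀ s : Set (Continua X), Bornology.IsBounded s := fun s => by
    have := (isometry_subtype_coe (s := {K : NonemptyCompacts X | IsConnected (K : Set X)}))
    exact (this.antilipschitz.isBounded_preimage
      (isBounded_of_compactSpace (s := Set.univ))).subset fun _ _ => mem_univ _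
  have hy : (⟨{y}, single y⟩ : Continua X) ∈ closure (Ws f) := by
    refine subset_closure (mem_Ws_iff.2 fun ε hε => ⟨0, ?_⟩)
    intro n _ a ha b hb
    obtain rfl : a = y := by simpa using ha
    obtain rfl : b = a := by simpa using hb
    simpa using hε.le
  obtain ⟨a₀, ha₀⟩ := A.nonempty
  obtain ⟨B, hB, hBy⟩ := exists_dist_lt_of_hausdorffDist_lt' hy (hN n hn)
    (hausdorffEDist_ne_top_of_nonempty_of_bounded
      ⟨⟨{(⇑f.symm)^[n] a₀}, single _⟩, by
        show (({(⇑f.symm)^[n] a₀} : NonemptyCompacts X) : Set X) ⊆ _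
        rw [NonemptyCompacts.coe_singleton, singleton_subset_iff]
        exact mem_image_of_mem _ ha₀⟩ ⟨_, hy⟩ (hbdd _) (hbdd _))
  rw [Subtype.dist_eq, NonemptyCompacts.dist_eq] at hBy
  obtain ⟨b, hb, hby⟩ := exists_dist_lt_of_hausdorffDist_lt' (y := y) (by simp) hBy
    (hausdorffEDist_ne_top_of_nonempty_of_bounded B.1.nonempty (by simp)
      B.1.isCompact.isBounded (by simp))
  obtain ⟨a, ha, rfl⟩ := hB hb
  exact ⟨a, ha, by rwa [dist_comm]⟩

theorem dense_setOf_exists_mem_Ws {f : X ≃ₜ X} {δ : ℝ} (hd : HasDenseBackwardIterates f)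
    (hδ : IsCWConstant f δ) (hδ0 : 0 < δ)
    (hA : ∃ A : Continua X, A ∈ Ws f ∧ (A.1 : Set X).Nontrivial) (x : X) :
    Dense {y : X | ∃ A : Continua X, A ∈ Ws f ∧ x ∈ (A.1 : Set X) ∧ y ∈ (A.1 : Set X)} := by
  obtain ⟨A, hst, hnt⟩ := hA
  rw [Metric.dense_iff]
  intro y ε hε
  obtain ⟨C, hC, hCst, hxC, z, hz, hyz⟩ := hd.exists_stable_near hδ hδ0 A.2.isPreconnected
    (mem_Ws_iff.1 hst) hnt x y (half_pos hε)
  refine ⟨z, ?_, ⟨C, C.nonempty, hC⟩, mem_Ws_iff.2 hCst, hxC, hz⟩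
  rw [Metric.mem_ball, dist_comm]
  linarith

end Compact

/-- For a cw-expansive homeomorphism of a continuum satisfying (PA): if there is a
nontrivial stable continuum then CWˢ_f(x) = {y : some stable continuum contains x and y}
is dense for every x; analogously for unstable continua. -/
theorem CW_sets_dense
    [CompactSpace X] [ConnectedSpace X] (f : X ≃ₜ X)
    (hcw : IsCWExpansive f) (hPA : CondPA f) :
    ((∃ A : Continua X, A ∈ Ws f ∧ (A.1 : Set X).Nontrivial) →
      ∀ x : X, Dense {y : X | ∃ A : Continua X, A ∈ Ws f ∧
        x ∈ (A.1 : Set X) ∧ y ∈ (A.1 : Set X)}) ∧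
    ((∃ A : Continua X, A ∈ Wu f ∧ (A.1 : Set X).Nontrivial) →
      ∀ x : X, Dense {y : X | ∃ A : Continua X, A ∈ Wu f ∧
        x ∈ (A.1 : Set X) ∧ y ∈ (A.1 : Set X)}) := by
  obtain ⟨δ, hδ0, hδ⟩ := hcw.exists_isCWConstant
  exact ⟨dense_setOf_exists_mem_Ws (hasDenseBackwardIterates_of_tendsto hPA.1) hδ hδ0,
    dense_setOf_exists_mem_Ws (hasDenseBackwardIterates_of_tendsto hPA.2) hδ.symm hδ0⟩
end

section
/- Let f : T² → T² be the hyperbolic toral automorphism f(x,y) = (2x+y, x+y) and C(Fˢ) the set of continua of T² contained in a single stable leaf of f. Then the closure of C(Fˢ) in the hyperspace (C(T²), dist_H) equals C(Fˢ) ∪ {T²}; that is, the only continuum that is a Hausdorff limit of stable arcs but is not itself contained in a stable leaf is the whole torus. -/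
open Metric Set Filter TopologicalSpace

instance : Fact ((0:ℝ) < 1) := ⟨zero_lt_one⟩

/-- The flat torus T² = (ℝ/ℤ) × (ℝ/ℤ). -/
abbrev T2 : Type := AddCircle (1:ℝ) × AddCircle (1:ℝ)

/-- The quotient map π : ℝ² → T². -/
noncomputable def pr (p : ℝ × ℝ) : T2 := (↑p.1, ↑p.2)

/-- The stable eigenvector v = (1, -(1+√5)/2) of [[2,1],[1,1]]. -/
noncomputable def vs : ℝ × ℝ := (1, -((1 + Real.sqrt 5) / 2))

/-- The stable leaf through x. -/
noncomputable def stLeaf (x : T2) : Set T2 := range fun t : ℝ => x + pr (t • vs)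

/-- C(Fˢ): the continua of T² contained in a single stable leaf. -/
noncomputable def CFs : Set (Continua T2) := {A | ∃ x : T2, (A.1 : Set T2) ⊆ stLeaf x}

/-- The whole torus as an element of the hyperspace. -/
noncomputable def wholeT2 : Continua T2 :=
  ⟨⟨⟨univ, isCompact_univ⟩, univ_nonempty⟩, isConnected_univ⟩

open scoped Topology

lemma continuous_pr : Continuous pr :=
  ((AddCircle.continuous_mk' (1 : ℝ)).comp continuous_fst).prodMk
    ((AddCircle.continuous_mk' (1 : ℝ)).comp continuous_snd)

lemma isOpenMap_pr : IsOpenMap pr :=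
  IsOpenMap.prodMap QuotientAddGroup.isOpenMap_coe QuotientAddGroup.isOpenMap_coe

lemma pr_zero : pr 0 = 0 := by
  simp [pr]

lemma pr_add (p q : ℝ × ℝ) : pr (p + q) = pr p + pr q := by
  simp [pr]

lemma pr_neg (p : ℝ × ℝ) : pr (-p) = -pr p := by
  simp [pr]

lemma pr_surjective : Function.Surjective pr := by
  rintro ⟨a, b⟩
  obtain ⟨a, rfl⟩ := QuotientAddGroup.mk_surjective a
  obtain ⟨b, rfl⟩ := QuotientAddGroup.mk_surjective b
  exact ⟨(a, b), rfl⟩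

lemma norm_pr_vertical_le (u : ℝ) : ‖pr (0, u)‖ ≤ |u| := by
  rw [Prod.norm_def]
  refine max_le (by simp [pr]) ?_
  exact QuotientAddGroup.norm_mk_le_norm

lemma continuous_pr_smul_vs : Continuous fun t : ℝ => pr (t • vs) :=
  continuous_pr.comp (by fun_prop)

/-- The forward stable half-leaf through `0` is dense in the torus. -/
lemma exists_nonneg_dist_pr_smul_vs_lt (z : T2) {ε : ℝ} (hε : 0 < ε) :
    ∃ t : ℝ, 0 ≤ t ∧ dist z (pr (t • vs)) < ε := by
  obtain ⟨⟨a, b⟩, rfl⟩ := pr_surjective z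
  have hirr : Irrational (vs.2 / 1) := by
    rw [div_one]
    exact Real.goldenRatio_irrational.neg
  have hd : DenseRange (· • (vs.2 : AddCircle (1 : ℝ)) : ℕ → AddCircle (1 : ℝ)) :=
    denseRange_zsmul_iff_nsmul.1 (AddCircle.denseRange_zsmul_coe_iff.2 hirr)
  obtain ⟨n, hn⟩ := hd.exists_dist_lt ((b - Int.fract a * vs.2 : ℝ) : AddCircle (1 : ℝ)) hε
  refine ⟨Int.fract a + n, by positivity, ?_⟩
  have h1 : ((((Int.fract a + n) • vs).1 : ℝ) : AddCircle (1 : ℝ)) = (a : AddCircle (1 : ℝ)) := by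
    rw [← sub_eq_zero, ← AddCircle.coe_sub, AddCircle.coe_eq_zero_iff]
    refine ⟨n - ⌊a⌋, ?_⟩
    simp [vs, ← Int.self_sub_floor]
    ring
  have h2 : ((((Int.fract a + n) • vs).2 : ℝ) : AddCircle (1 : ℝ)) =
      n • (vs.2 : AddCircle (1 : ℝ)) + ((Int.fract a * vs.2 : ℝ) : AddCircle (1 : ℝ)) := by
    rw [← AddCircle.coe_nsmul, ← AddCircle.coe_add]
    congr 1
    simp
    ring
  rw [pr, pr, Prod.dist_eq, h1, h2]
  refine max_lt (by simpa using hε) ?_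
  rw [AddCircle.coe_sub, dist_eq_norm, sub_sub, add_comm] at hn
  rwa [dist_eq_norm]

/-- Stable arcs of large length are uniformly dense in the torus. -/
lemma exists_forall_dist_add_pr_smul_vs_lt {ε : ℝ} (hε : 0 < ε) :
    ∃ L : ℝ, ∀ x y : T2, ∃ t ∈ Icc 0 L, dist y (x + pr (t • vs)) < ε := by
  obtain ⟨s, hs⟩ := (isCompact_univ (X := T2)).elim_finite_subcover
    (fun t : Ici (0 : ℝ) => ball (pr (t.1 • vs)) ε) (fun _ => isOpen_ball) (fun z _ => by
      obtain ⟨t, ht, h⟩ := exists_nonneg_dist_pr_smul_vs_lt z hε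
      exact mem_iUnion.2 ⟨⟨t, ht⟩, h⟩)
  obtain ⟨L, hL⟩ := (s.finite_toSet.image Subtype.val).bddAbove
  refine ⟨L, fun x y => ?_⟩
  obtain ⟨t, ht, h⟩ := mem_iUnion₂.1 (hs (mem_univ (y - x)))
  refine ⟨t, ⟨t.2, hL ⟨t, ht, rfl⟩⟩, ?_⟩
  rw [mem_ball, dist_eq_norm, sub_sub] at h
  rwa [dist_eq_norm]

/-- The vertical displacements that return to the same stable leaf form a countable set. -/
lemma countable_vertical_mem_stLeaf_zero : {u : ℝ | pr (0, u) ∈ stLeaf 0}.Countable := by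
  refine (countable_range fun p : ℤ × ℤ => (p.1 : ℝ) * vs.2 + p.2).mono ?_
  rintro u ⟨t, ht⟩
  simp only [pr, zero_add, Prod.mk.injEq] at ht
  obtain ⟨h1, h2⟩ := ht
  rw [← sub_eq_zero, ← AddCircle.coe_sub, AddCircle.coe_eq_zero_iff] at h1 h2
  obtain ⟨m, hm⟩ := h1
  obtain ⟨n, hn⟩ := h2
  refine ⟨(m, -n), ?_⟩
  simp [vs] at hm hn ⊢
  rw [hm]
  linarith

lemma mem_stLeaf_iff {x y : T2} : y ∈ stLeaf x ↔ y - x ∈ stLeaf 0 := by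
  simp only [stLeaf, mem_range, zero_add]
  exact exists_congr fun t => ⟨fun h => by rw [← h]; abel, fun h => by rw [h]; abel⟩

lemma sub_mem_stLeaf_zero {x y : T2} (hx : x ∈ stLeaf 0) (hy : y ∈ stLeaf 0) :
    x - y ∈ stLeaf 0 := by
  obtain ⟨s, rfl⟩ := hx
  obtain ⟨t, rfl⟩ := hy
  exact ⟨s - t, by simp only [sub_smul, sub_eq_add_neg (s • vs), pr_add, pr_neg]; abel⟩

/-- Foliated coordinates around the stable leaf through `x`: the first coordinate runs along the
leaf and the second one is vertical. -/
noncomputable def leafChart (x : T2) (q : ℝ × ℝ) : T2 := x + pr (q.1 • vs + (0, q.2))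

lemma leafChart_apply (x : T2) (s u : ℝ) :
    leafChart x (s, u) = x + pr (s • vs) + pr (0, u) := by
  rw [leafChart, pr_add, add_assoc]

lemma continuous_leafChart (x : T2) : Continuous (leafChart x) :=
  continuous_const.add (continuous_pr.comp (by fun_prop))

lemma isOpenMap_leafChart (x : T2) : IsOpenMap (leafChart x) := by
  let e : (ℝ × ℝ) ≃ₜ (ℝ × ℝ) :=
    { toFun := fun q => q.1 • vs + (0, q.2)
      invFun := fun q => (q.1, q.2 - q.1 * vs.2)
      left_inv := fun q => by ext <;> simp [vs]
      right_inv := fun q => by ext <;> simp [vs]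
      continuous_toFun := by fun_prop
      continuous_invFun := by fun_prop }
  exact (Homeomorph.addLeft x).isOpenMap.comp (isOpenMap_pr.comp e.isOpenMap)

lemma exists_forall_leafChart_notMem {K : Set T2} (hK : IsClosed K) {x : T2} {a : ℝ}
    (ha : x + pr (a • vs) ∉ K) : ∃ δ > 0, ∀ u, |u| < δ → leafChart x (a, u) ∉ K := by
  have hc : Continuous fun u => leafChart x (a, u) :=
    (continuous_leafChart x).comp (by fun_prop)
  have h0 : leafChart x (a, 0) ∉ K := by
    rwa [leafChart_apply, Prod.mk_zero_zero, pr_zero, add_zero]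
  obtain ⟨δ, hδ, h⟩ := Metric.isOpen_iff.1 (hK.isOpen_compl.preimage hc) 0 h0
  exact ⟨δ, hδ, fun u hu => h (by simpa using hu)⟩

/-- A continuum contained in a stable leaf which misses a point of the leaf on each side of one of
its points is contained in the arc between the two missed points. -/
lemma subset_arc_of_subset_stLeaf {K : Set T2} (hK : IsClosed K) (hconn : IsPreconnected K)
    {x : T2} (hx : x ∈ K) (hleaf : K ⊆ stLeaf x) {a b : ℝ} (ha0 : a < 0) (hb0 : 0 < b)
    (ha : x + pr (a • vs) ∉ K) (hb : x + pr (b • vs) ∉ K) :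
    K ⊆ (fun t : ℝ => x + pr (t • vs)) '' Icc a b := by
  intro p hp
  have hcl : IsClosed ((fun t : ℝ => x + pr (t • vs)) '' Icc a b) :=
    (isCompact_Icc.image (continuous_const.add continuous_pr_smul_vs)).isClosed
  refine (Metric.mem_of_closed' hcl).2 fun ε hε => ?_
  obtain ⟨δa, hδa, hKa⟩ := exists_forall_leafChart_notMem hK ha
  obtain ⟨δb, hδb, hKb⟩ := exists_forall_leafChart_notMem hK hb
  obtain ⟨η, hη, hη0, hηlt⟩ := (countable_vertical_mem_stLeaf_zero.dense_compl ℝ).exists_between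
    (lt_min hε (lt_min hδa hδb))
  have hηε : η < ε := hηlt.trans_le (min_le_left _ _)
  have hηa : η < δa := hηlt.trans_le ((min_le_right _ _).trans (min_le_left _ _))
  have hηb : η < δb := hηlt.trans_le ((min_le_right _ _).trans (min_le_right _ _))
  have hvert : ∀ s u, leafChart x (s, u) ∈ K → pr (0, u) ∈ stLeaf 0 := by
    intro s u hsu
    have h := mem_stLeaf_iff.1 (hleaf hsu)
    have hs : pr (s • vs) ∈ stLeaf 0 := ⟨s, zero_add _⟩
    have := sub_mem_stLeaf_zero h hs
    rw [leafChart_apply] at this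
    convert this using 1
    abel
  set O := leafChart x '' (Ioo a b ×ˢ Ioo (-η) η)
  set C := leafChart x '' (Icc a b ×ˢ Icc (-η) η)
  have hO : IsOpen O := isOpenMap_leafChart x _ (isOpen_Ioo.prod isOpen_Ioo)
  have hC : IsClosed C :=
    ((isCompact_Icc.prod isCompact_Icc).image (continuous_leafChart x)).isClosed
  have hOC : O ⊆ C := image_mono (prod_mono Ioo_subset_Icc_self Ioo_subset_Icc_self)
  have hKC : K ∩ C ⊆ O := by
    rintro _ ⟨hq, ⟨s, u⟩, ⟨hs, hu⟩, rfl⟩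
    have hu' : |u| ≤ η := abs_le.2 hu
    have hs1 : s ≠ a := by
      rintro rfl
      exact hKa u (hu'.trans_lt hηa) hq
    have hs2 : s ≠ b := by
      rintro rfl
      exact hKb u (hu'.trans_lt hηb) hq
    have hu1 : u ≠ η := by
      rintro rfl
      exact hη (hvert s u hq)
    have hu2 : u ≠ -η := by
      rintro rfl
      refine hη ?_
      have := sub_mem_stLeaf_zero (x := 0) ⟨0, by simp [pr]⟩ (hvert s _ hq)
      rwa [zero_sub, ← pr_neg, Prod.neg_mk, neg_neg, neg_zero] at this
    exact ⟨(s, u), ⟨⟨lt_of_le_of_ne hs.1 hs1.symm, lt_of_le_of_ne hs.2 hs2⟩,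
      ⟨lt_of_le_of_ne hu.1 hu2.symm, lt_of_le_of_ne hu.2 hu1⟩⟩, rfl⟩
  have hxO : x ∈ O :=
    ⟨(0, 0), ⟨⟨ha0, hb0⟩, ⟨neg_lt_zero.2 hη0, hη0⟩⟩, by simp [leafChart, pr]⟩
  have hKO : K ⊆ O := by
    refine hconn.subset_left_of_subset_union hO hC.isOpen_compl
      (disjoint_compl_right.mono_left hOC) (fun q hq => ?_) ⟨x, hx, hxO⟩
    by_cases hqC : q ∈ C
    · exact Or.inl (hKC ⟨hq, hqC⟩)
    · exact Or.inr hqC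
  obtain ⟨⟨s, u⟩, ⟨hs, hu⟩, rfl⟩ := hKO hp
  refine ⟨_, ⟨s, Ioo_subset_Icc_self hs, rfl⟩, ?_⟩
  rw [leafChart_apply, dist_eq_norm, add_sub_cancel_left]
  exact (norm_pr_vertical_le u).trans_lt ((abs_lt.2 hu).trans hηε)

/-- A continuum contained in a stable leaf which misses a ball is contained in an arc whose length
depends only on the radius of the ball. -/
lemma subset_arc_of_forall_le_dist {ε L : ℝ}
    (hL : ∀ x y : T2, ∃ t ∈ Icc 0 L, dist y (x + pr (t • vs)) < ε)
    {K : Set T2} (hK : IsClosed K) (hconn : IsPreconnected K) {x y : T2} (hx : x ∈ K)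
    (hleaf : K ⊆ stLeaf x) (hy : ∀ p ∈ K, ε ≤ dist p y) :
    K ⊆ (fun t : ℝ => x + pr (t • vs)) '' Icc (-L) L := by
  obtain ⟨b, hb, hyb⟩ := hL x y
  obtain ⟨a, ha, hya⟩ := hL y x
  have hb' : x + pr (b • vs) ∉ K := fun h => (hy _ h).not_gt (by rwa [dist_comm])
  have ha' : x + pr ((-a) • vs) ∉ K := fun h => (hy _ h).not_gt (by
    rw [dist_eq_norm] at hya ⊢
    rwa [neg_smul, pr_neg, ← sub_eq_add_neg, sub_right_comm, sub_sub])
  have h0 : x + pr ((0 : ℝ) • vs) ∈ K := by simpa [pr_zero] using hx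
  have hb0 : 0 < b := hb.1.lt_of_ne (by rintro rfl; exact hb' h0)
  have ha0 : 0 < a := ha.1.lt_of_ne (by rintro rfl; exact ha' (by simpa using h0))
  refine (subset_arc_of_subset_stLeaf hK hconn hx hleaf (neg_lt_zero.2 ha0) hb0 ha' hb').trans
    (image_mono (Icc_subset_Icc (neg_le_neg ha.2) hb.2))

lemma Continua.exists_dist_lt {X : Type*} [MetricSpace X] {A B : Continua X} {r : ℝ}
    (h : dist A B < r) {p : X} (hp : p ∈ (A.1 : Set X)) : ∃ q ∈ (B.1 : Set X), dist p q < r :=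
  exists_dist_lt_of_hausdorffDist_lt hp h
    (hausdorffEDist_ne_top_of_nonempty_of_bounded A.1.nonempty B.1.nonempty
      A.1.isCompact.isBounded B.1.isCompact.isBounded)

lemma wholeT2_mem_closure_CFs : wholeT2 ∈ closure CFs := by
  refine Metric.mem_closure_iff.2 fun ε hε => ?_
  obtain ⟨L, hL⟩ := exists_forall_dist_add_pr_smul_vs_lt (half_pos hε)
  have hne : (Icc 0 L).Nonempty := let ⟨t, ht, _⟩ := hL 0 0; ⟨t, ht⟩
  have hc : Continuous fun t : ℝ => (0 : T2) + pr (t • vs) :=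
    continuous_const.add continuous_pr_smul_vs
  let A : Continua T2 := ⟨⟨⟨_, isCompact_Icc.image hc⟩, hne.image _⟩,
    (isConnected_Icc (nonempty_Icc.1 hne)).image _ hc.continuousOn⟩
  refine ⟨A, ⟨0, image_subset_range _ _⟩, ?_⟩
  refine lt_of_le_of_lt (hausdorffDist_le_of_mem_dist (half_pos hε).le (fun y _ => ?_)
    fun y _ => ⟨y, mem_univ y, (dist_self y).trans_le (half_pos hε).le⟩) (half_lt_self hε)
  obtain ⟨t, ht, h⟩ := hL 0 y
  exact ⟨_, ⟨t, ht, rfl⟩, h.le⟩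

lemma mem_CFs_of_mem_closure {A : Continua T2} (hA : A ∈ closure CFs) {y : T2}
    (hy : y ∉ (A.1 : Set T2)) : A ∈ CFs := by
  obtain ⟨r, hr, hball⟩ := Metric.isOpen_iff.1 A.1.isCompact.isClosed.isOpen_compl y hy
  obtain ⟨L, hL⟩ := exists_forall_dist_add_pr_smul_vs_lt (half_pos hr)
  have key : ∀ n : ℕ, ∃ x : T2, ∀ p ∈ (A.1 : Set T2),
      ∃ t ∈ Icc (-L) L, dist p (x + pr (t • vs)) < 1 / ((n : ℝ) + 1) := by
    intro n
    obtain ⟨B, ⟨x₀, hB⟩, hAB⟩ := Metric.mem_closure_iff.1 hA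
      (min (r / 2) (1 / ((n : ℝ) + 1))) (lt_min (half_pos hr) (by positivity))
    obtain ⟨x, hx⟩ := B.1.nonempty
    have hBx : (B.1 : Set T2) ⊆ stLeaf x := fun p hp => by
      have := sub_mem_stLeaf_zero (mem_stLeaf_iff.1 (hB hp)) (mem_stLeaf_iff.1 (hB hx))
      rw [sub_sub_sub_cancel_right] at this
      exact mem_stLeaf_iff.2 this
    have hBy : ∀ p ∈ (B.1 : Set T2), r / 2 ≤ dist p y := by
      intro p hp
      by_contra! h
      obtain ⟨q, hq, hpq⟩ := Continua.exists_dist_lt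
        (by rw [dist_comm]; exact hAB.trans_le (min_le_left _ _)) hp
      refine hball (show q ∈ ball y r from ?_) hq
      rw [mem_ball]
      linarith [dist_triangle_left q y p]
    have hsub := subset_arc_of_forall_le_dist hL B.1.isCompact.isClosed B.2.isPreconnected hx
      hBx hBy
    refine ⟨x, fun p hp => ?_⟩
    obtain ⟨q, hq, hpq⟩ := Continua.exists_dist_lt (hAB.trans_le (min_le_right _ _)) hp
    obtain ⟨t, ht, rfl⟩ := hsub hq
    exact ⟨t, ht, hpq⟩
  choose x hx using key
  obtain ⟨a, φ, hφ, hxa⟩ := CompactSpace.tendsto_subseq x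
  refine ⟨a, fun p hp => ?_⟩
  choose t ht hpt using fun n => hx n p hp
  have hJ : IsClosed ((fun t : ℝ => pr (t • vs)) '' Icc (-L) L) :=
    (isCompact_Icc.image continuous_pr_smul_vs).isClosed
  have hlim : Tendsto (fun n => x n + pr (t n • vs)) atTop (𝓝 p) := by
    refine tendsto_iff_dist_tendsto_zero.2 (squeeze_zero (fun _ => dist_nonneg) (fun n => ?_)
      tendsto_one_div_add_atTop_nhds_zero_nat)
    rw [dist_comm]
    exact (hpt n).le
  have hlim' : Tendsto (fun n => pr (t (φ n) • vs)) atTop (𝓝 (p - a)) := by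
    simpa [Function.comp_def] using (hlim.comp hφ.tendsto_atTop).sub hxa
  obtain ⟨s, -, hs⟩ := hJ.mem_of_tendsto hlim' (Eventually.of_forall fun n => ⟨_, ht _, rfl⟩)
  exact ⟨s, by simp only at hs; simp only [hs, add_sub_cancel]⟩

/-- The closure of C(Fˢ) in the hyperspace (C(T²), dist_H) equals C(Fˢ) ∪ {T²}. -/
theorem closure_CFs_eq : closure CFs = CFs ∪ {wholeT2} := by
  refine Subset.antisymm (fun A hA => ?_)
    (union_subset subset_closure (singleton_subset_iff.2 wholeT2_mem_closure_CFs))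
  by_cases h : (A.1 : Set T2) = univ
  · exact Or.inr (Subtype.ext (SetLike.coe_injective h))
  · obtain ⟨y, hy⟩ := (ne_univ_iff_exists_notMem _).1 h
    exact Or.inl (mem_CFs_of_mem_closure hA hy)
end
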